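/- If (R,m) is a complete Noetherian local domain of positive prime characteristic p, then there exists a balanced big Cohen-Macaulay R-algebra, i.e., an R-algebra B with mB ≠ B on which every system of parameters of R is a regular sequence. -/

import Mathlib

open IsLocalRing

universe u v w

/-- `x` is a system of parameters of the local ring `R`: a sequence of `dim R` elements
of the maximal ideal generating an ideal primary to the maximal ideal. -/
def IsSOP (R : Type*) [CommRing R] [IsLocalRing R] {n : ℕ} (x : Fin n → R) : Prop :=
  (n : WithBot ℕ∞) = ringKrullDim R ∧
  (∀ i, x i ∈ maximalIdeal R) ∧
  (Ideal.span (Set.range x)).radical = maximalIdeal R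

/-- The sequence `x` of elements of `R` is a regular sequence on the `R`-module `M`. -/
def IsRegSeq (R : Type*) [CommRing R] (M : Type*) [AddCommGroup M] [Module R M]
    {n : ℕ} (x : Fin n → R) : Prop :=
  RingTheory.Sequence.IsRegular M (List.ofFn x)

/-- `B` is a big Cohen-Macaulay algebra over the local ring `R`: some system of
parameters of `R` is a regular sequence on `B` (and in particular `mB ≠ B`). -/
def IsBigCM (R : Type*) [CommRing R] [IsLocalRing R]
    (B : Type*) [CommRing B] [Algebra R B] : Prop :=
  (∃ (n : ℕ) (x : Fin n → R), IsSOP R x ∧ IsRegSeq R B x) ∧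
  (maximalIdeal R).map (algebraMap R B) ≠ ⊤

/-- `B` is a balanced big Cohen-Macaulay algebra over the local ring `R`: every system of
parameters of `R` is a regular sequence on `B` (and in particular `mB ≠ B`). -/
def IsBalancedBigCM (R : Type*) [CommRing R] [IsLocalRing R]
    (B : Type*) [CommRing B] [Algebra R B] : Prop :=
  (∀ (n : ℕ) (x : Fin n → R), IsSOP R x → IsRegSeq R B x) ∧
  (maximalIdeal R).map (algebraMap R B) ≠ ⊤

/-- `S` is a seed over the local ring `R`: `S` admits an `R`-algebra homomorphism to some
big Cohen-Macaulay `R`-algebra. -/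
def IsSeed (R : Type u) [CommRing R] [IsLocalRing R]
    (S : Type v) [CommRing S] [Algebra R S] : Prop :=
  ∃ (B : Type (max u v)) (_ : CommRing B) (_ : Algebra R B),
    IsBigCM R B ∧ Nonempty (S →ₐ[R] B)

/-- A field of characteristic `p` lifts along square-zero extensions of rings of
characteristic `p`. -/
theorem exists_ringHom_lift_of_sq_eq_bot (p : ℕ) [Fact p.Prime] {K B : Type*} [Field K]
    [CommRing B] [CharP K p] [CharP B p] (I : Ideal B) (hI : I ^ 2 = ⊥) (g : K →+* B ⧸ I) :
    ∃ f : K →+* B, (Ideal.Quotient.mk I).comp f = g := by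
  have hp : p.Prime := Fact.out
  have hfrob : ∀ b ∈ I, frobenius B p b = 0 := fun b hb ↦ by
    have h : b ^ 2 = 0 := by
      rw [← Ideal.mem_bot, ← hI]
      exact Ideal.pow_mem_pow hb 2
    exact pow_eq_zero_of_le hp.two_le h
  let φ : B ⧸ I →+* B := Ideal.Quotient.lift I (frobenius B p) hfrob
  have hφ : ∀ b, φ (Ideal.Quotient.mk I b) = b ^ p := fun b ↦ rfl
  have hmkφ : ∀ x, Ideal.Quotient.mk I (φ x) = x ^ p := fun x ↦ by
    obtain ⟨b, rfl⟩ := Ideal.Quotient.mk_surjective x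
    rw [hφ, map_pow]
  let s : Set (Subring (K × B)) := {G | (∀ a, (a ^ p, φ (g a)) ∈ G) ∧
    (∀ z ∈ G, Ideal.Quotient.mk I z.2 = g z.1) ∧ ∀ z ∈ G, z.1 = 0 → z.2 = 0}
  have hG₀ : ((frobenius K p).prod (φ.comp g)).range ∈ s := by
    refine ⟨fun a ↦ ⟨a, rfl⟩, ?_, ?_⟩
    · rintro _ ⟨a, rfl⟩
      simp [hmkφ, frobenius_def]
    · rintro _ ⟨a, rfl⟩ ha
      have : a = 0 := eq_zero_of_pow_eq_zero ha
      simp [this]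
  obtain ⟨G, -, hG, hmax⟩ := zorn_le_nonempty₀ s (fun c hc hch y hy ↦ by
    have hdir := hch.directedOn
    have hne : c.Nonempty := ⟨y, hy⟩
    refine ⟨sSup c, ⟨fun a ↦ ?_, fun z hz ↦ ?_, fun z hz ↦ ?_⟩, fun z hz ↦ le_sSup hz⟩
    · exact (Subring.mem_sSup_of_directedOn hne hdir).2 ⟨y, hy, (hc hy).1 a⟩
    · obtain ⟨G, hG, hzG⟩ := (Subring.mem_sSup_of_directedOn hne hdir).1 hz
      exact (hc hG).2.1 z hzG
    · obtain ⟨G, hG, hzG⟩ := (Subring.mem_sSup_of_directedOn hne hdir).1 hz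
      exact (hc hG).2.2 z hzG) _ hG₀
  obtain ⟨hG₁, hG₂, hG₃⟩ := hG
  have hinj : ∀ z w : G, z.1.1 = w.1.1 → z = w := fun z w h ↦ by
    have h₁ : (z - w).1.1 = 0 := by simp [h]
    have h₂ : (z - w).1.2 = 0 := hG₃ _ (z - w).2 h₁
    refine Subtype.ext (Prod.ext h (sub_eq_zero.1 ?_))
    simpa using h₂
  have hsurj : ∀ a : K, ∃ z : G, z.1.1 = a := by
    by_contra! hcon
    obtain ⟨b, hb⟩ := hcon
    have hfield : IsField G := by
      refine ⟨⟨0, 1, fun h ↦ ?_⟩, mul_comm, fun {a} ha ↦ ?_⟩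
      · have : (0 : K) = 1 := congr_arg (fun z : G ↦ z.1.1) h
        exact zero_ne_one this
      · have ha' : a.1.1 ≠ 0 := fun h ↦ ha (hinj a 0 h)
        refine ⟨a ^ (p - 1) * ⟨_, hG₁ (a.1.1)⁻¹⟩, hinj _ _ ?_⟩
        change a.1.1 * (a.1.1 ^ (p - 1) * (a.1.1)⁻¹ ^ p) = 1
        rw [← mul_assoc, ← pow_succ', Nat.sub_add_cancel hp.one_le, ← mul_pow,
          mul_inv_cancel₀ ha', one_pow]
    let : Field G := hfield.toField
    obtain ⟨β, hβ⟩ := Ideal.Quotient.mk_surjective (g b)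
    let ev : Polynomial G →+* K × B := Polynomial.eval₂RingHom G.subtype (b, β)
    let q : Polynomial G := Polynomial.X ^ p - Polynomial.C ⟨_, hG₁ b⟩
    have hevC : ∀ z : G, ev (Polynomial.C z) = z := fun z ↦ Polynomial.eval₂_C _ _
    have hevX : ev Polynomial.X = (b, β) := Polynomial.eval₂_X _ _
    have hevq : ev q = 0 := by
      have hφβ : φ (g b) = β ^ p := by rw [← hβ, hφ]
      rw [map_sub, map_pow, hevX, hevC, sub_eq_zero]
      exact Prod.ext rfl hφβ.symm
    have hq : Irreducible q := X_pow_sub_C_irreducible_of_prime hp fun z hz ↦ by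
      have h : z.1.1 ^ p = b ^ p := congr_arg (fun z : G ↦ z.1.1) hz
      exact hb z (frobenius_inj K p h)
    have hmem : ev.range ∈ s := by
      refine ⟨fun a ↦ ⟨Polynomial.C ⟨_, hG₁ a⟩, hevC _⟩, ?_, ?_⟩
      · rintro _ ⟨P, rfl⟩
        have h : ((Ideal.Quotient.mk I).comp (RingHom.snd K B)).comp ev =
            (g.comp (RingHom.fst K B)).comp ev := by
          refine Polynomial.ringHom_ext (fun z ↦ ?_) ?_
          · simpa [hevC] using hG₂ z z.2
          · simpa [hevX] using hβ
        exact RingHom.congr_fun h P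
      · rintro _ ⟨P, rfl⟩ hP
        rcases dvd_or_isCoprime q P hq with ⟨Q, rfl⟩ | ⟨u, v, huv⟩
        · simp [hevq]
        · have h := congr_arg (fun P ↦ (ev P).1) huv
          simp [hevq, hP] at h
    have hle : ev.range ≤ G := hmax hmem fun z hz ↦ ⟨Polynomial.C ⟨z, hz⟩, hevC _⟩
    exact hb ⟨(b, β), hle ⟨Polynomial.X, hevX⟩⟩ rfl
  let e : G ≃+* K := RingEquiv.ofBijective ((RingHom.fst K B).comp G.subtype)
    ⟨fun z w h ↦ hinj z w h, hsurj⟩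
  refine ⟨((RingHom.snd K B).comp G.subtype).comp e.symm.toRingHom, RingHom.ext fun a ↦ ?_⟩
  obtain ⟨z, rfl⟩ := e.surjective a
  simp only [RingHom.comp_apply, RingEquiv.toRingHom_eq_coe, RingHom.coe_coe,
    RingEquiv.symm_apply_apply]
  exact hG₂ z z.2

/-- Every field of characteristic `p` is formally smooth over the prime field. -/
theorem formallySmooth_zmod (p : ℕ) [Fact p.Prime] (K : Type*) [Field K] [Algebra (ZMod p) K] :
    Algebra.FormallySmooth (ZMod p) K := by
  refine Algebra.FormallySmooth.of_comp_surjective fun B _ _ I hI g ↦ ?_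
  cases subsingleton_or_nontrivial B
  · refine ⟨⟨⟨⟨⟨fun _ ↦ 0, Subsingleton.elim _ _⟩, fun _ _ ↦ Subsingleton.elim _ _⟩,
      Subsingleton.elim _ _, fun _ _ ↦ Subsingleton.elim _ _⟩,
      fun _ ↦ Subsingleton.elim _ _⟩, ?_⟩
    have : Subsingleton (B ⧸ I) := Ideal.Quotient.mk_surjective.subsingleton
    exact AlgHom.ext fun _ ↦ Subsingleton.elim _ _
  · have := charP_of_injective_algebraMap (algebraMap (ZMod p) K).injective p
    have := charP_of_injective_algebraMap (algebraMap (ZMod p) B).injective p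
    obtain ⟨f, hf⟩ := exists_ringHom_lift_of_sq_eq_bot p I hI (g : K →+* B ⧸ I)
    refine ⟨⟨f, fun r ↦ RingHom.congr_fun (Subsingleton.elim (f.comp (algebraMap (ZMod p) K))
      (algebraMap (ZMod p) B)) r⟩, ?_⟩
    exact AlgHom.ext fun a ↦ RingHom.congr_fun hf a

/-- A complete local ring of characteristic `p` contains a coefficient field. -/
theorem exists_residue_section (R : Type*) [CommRing R] [IsLocalRing R]
    [IsAdicComplete (maximalIdeal R) R] (p : ℕ) [Fact p.Prime] [CharP R p] :
    ∃ f : ResidueField R →+* R, ∀ a, residue R (f a) = a := by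
  let : Algebra (ZMod p) R := ZMod.algebra R p
  have := formallySmooth_zmod p (ResidueField R)
  obtain ⟨f, hf⟩ := Algebra.FormallySmooth.exists_mkₐ_comp_eq_of_isAdicComplete
    (R := ZMod p) (I := maximalIdeal R) (AlgHom.id (ZMod p) (ResidueField R))
  exact ⟨f, fun a ↦ AlgHom.congr_fun hf a⟩

/-- Evaluation of power series over `k` at elements of an ideal of definition of a complete
`k`-algebra. -/
theorem exists_mvPowerSeries_hom {k R σ : Type*} [CommRing k] [CommRing R] [Finite σ]
    (I : Ideal R) [IsAdicComplete I R] (f : k →+* R) (x : σ → R) (hx : ∀ i, x i ∈ I) :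
    ∃ φ : MvPowerSeries σ k →+* R,
      (∀ i, φ (MvPowerSeries.X i) = x i) ∧ ∀ a, φ (MvPowerSeries.C a) = f a := by
  let _ : UniformSpace k := ⊥
  have : DiscreteTopology k := ⟨rfl⟩
  have : IsUniformAddGroup k := inferInstance
  let _ : TopologicalSpace R := I.adicTopology
  have : IsTopologicalRing R := I.ringFilterBasis.isTopologicalRing
  have hI : IsAdic I := rfl
  let _ : UniformSpace R := IsTopologicalAddGroup.rightUniformSpace R
  have : IsUniformAddGroup R := isUniformAddGroup_of_addCommGroup
  have : IsLinearTopology R R := I.isLinearTopology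
  obtain ⟨_, _⟩ := hI.isAdicComplete_iff.1 ‹_›
  have hf : Continuous f := continuous_of_discreteTopology
  have hx' : MvPowerSeries.HasEval x := by
    refine ⟨fun i ↦ ?_, by simp⟩
    rw [IsTopologicallyNilpotent, hI.hasBasis_nhds_zero.tendsto_right_iff]
    intro n _
    filter_upwards [Filter.eventually_ge_atTop n] with m hm
    exact Ideal.pow_le_pow_right hm (Ideal.pow_mem_pow (hx i) m)
  refine ⟨MvPowerSeries.eval₂Hom hf hx', fun i ↦ ?_, fun a ↦ ?_⟩
  · rw [MvPowerSeries.coe_eval₂Hom, MvPowerSeries.eval₂_X]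
  · rw [MvPowerSeries.coe_eval₂Hom, MvPowerSeries.eval₂_C]

/-- A module of finite length over a local ring `R` is finite over every subring
surjecting onto the residue field. -/
theorem IsFiniteLength.module_finite_of_residue_surjective {k R : Type*} [CommRing k]
    [CommRing R] [IsLocalRing R] [Algebra k R]
    (hk : Function.Surjective (algebraMap k (ResidueField R)))
    {M : Type*} [AddCommGroup M] [Module R M] (hM : IsFiniteLength R M) :
    ∀ [Module k M] [IsScalarTower k R M], Module.Finite k M := by
  induction hM with
  | of_subsingleton => intros; infer_instance
  | @of_simple_quotient M _ _ N hN _ ih =>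
    intro _ _
    have hN : Module.Finite k (N.restrictScalars k) := ih
    have hq : Module.Finite k (M ⧸ N) := by
      obtain ⟨m, hm, ⟨e⟩⟩ := isSimpleModule_iff_quot_maximal.1 ‹IsSimpleModule R (M ⧸ N)›
      obtain rfl := IsLocalRing.eq_maximalIdeal hm
      have : Module.Finite k (R ⧸ maximalIdeal R) :=
        Module.Finite.of_surjective (Algebra.linearMap k (ResidueField R)) hk
      exact Module.Finite.equiv (e.symm.restrictScalars k)
    have : Module.Finite k (M ⧸ N.restrictScalars k) := hq
    exact Module.Finite.of_submodule_quotient (N.restrictScalars k)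

/-- Krull dimension does not increase along integral ring maps. -/
theorem ringKrullDim_le_of_isIntegral (A R : Type*) [CommRing A] [CommRing R] [Algebra A R]
    [Algebra.IsIntegral A R] : ringKrullDim R ≤ ringKrullDim A :=
  Order.krullDim_le_of_strictMono (PrimeSpectrum.comap (algebraMap A R)) fun _ _ h ↦
    Ideal.IsIntegral.comap_lt_comap h

/-- An integral ring map from a domain of finite dimension which does not decrease the
dimension is injective. -/
theorem algebraMap_injective_of_ringKrullDim_le (A R : Type*) [CommRing A] [IsDomain A]
    [FiniteRingKrullDim A] [CommRing R] [Algebra A R] [Algebra.IsIntegral A R]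
    (h : ringKrullDim A ≤ ringKrullDim R) : Function.Injective (algebraMap A R) := by
  refine (injective_iff_map_eq_zero _).2 fun r hr ↦ ?_
  by_contra hr₀
  let φ : A ⧸ Ideal.span {r} →+* R := Ideal.Quotient.lift _ (algebraMap A R) <| fun a ha ↦ by
    obtain ⟨b, rfl⟩ := Ideal.mem_span_singleton.1 ha
    simp [hr]
  algebraize [φ]
  have : IsScalarTower A (A ⧸ Ideal.span {r}) R := .of_algebraMap_eq fun _ ↦ rfl
  have : Algebra.IsIntegral (A ⧸ Ideal.span {r}) R := Algebra.IsIntegral.tower_top A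
  have h₁ := ringKrullDim_quotient_succ_le_of_nonZeroDivisor
    (mem_nonZeroDivisors_of_ne_zero hr₀)
  have h₂ := ringKrullDim_le_of_isIntegral (A ⧸ Ideal.span {r}) R
  have h₃ : ringKrullDim A + 1 ≤ ringKrullDim A :=
    (add_le_add_left (h.trans h₂) 1).trans h₁
  obtain ⟨m, hm⟩ := WithBot.ne_bot_iff_exists.1 (ringKrullDim_ne_bot (R := A))
  have htop := ringKrullDim_ne_top (R := A)
  rw [← hm] at h₃ htop
  have htop' : m ≠ ⊤ := fun h ↦ htop (by rw [h]; rfl)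
  lift m to ℕ using htop'
  norm_cast at h₃
  omega

theorem MvPowerSeries.mem_span_X_pow_iff {σ k : Type*} [CommRing k] (s : Finset σ) (q : ℕ)
    (f : MvPowerSeries σ k) :
    f ∈ Ideal.span ((fun i ↦ (MvPowerSeries.X i : MvPowerSeries σ k) ^ q) '' s) ↔
      ∀ m : σ →₀ ℕ, (∀ i ∈ s, m i < q) → MvPowerSeries.coeff m f = 0 := by
  classical
  induction s using Finset.induction_on generalizing f with
  | empty => simp [MvPowerSeries.ext_iff]
  | insert j s _ ih =>
    rw [Finset.coe_insert, Set.image_insert_eq, Ideal.mem_span_insert]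
    constructor
    · rintro ⟨a, z, hz, rfl⟩ m hm
      rw [map_add, (ih z).1 hz m fun i hi ↦ hm i (Finset.mem_insert_of_mem hi), add_zero]
      exact X_pow_dvd_iff.1 (Dvd.intro_left a rfl) m (hm j (Finset.mem_insert_self j s))
    · intro hf
      let z : MvPowerSeries σ k := fun m ↦ if m j < q then coeff m f else 0
      have hz : ∀ m, coeff m z = if m j < q then coeff m f else 0 := fun m ↦ rfl
      obtain ⟨a, ha⟩ : (X j : MvPowerSeries σ k) ^ q ∣ f - z := by
        refine X_pow_dvd_iff.2 fun m hm ↦ ?_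
        rw [map_sub, hz, if_pos hm, sub_self]
      refine ⟨a, z, (ih z).2 fun m hm ↦ ?_, by rw [mul_comm, ← ha, sub_add_cancel]⟩
      rw [hz]
      split_ifs with h
      · exact hf m ((Finset.forall_mem_insert _ _ _).2 ⟨h, hm⟩)
      · rfl

/-- Powers of the variables form a regular sequence, in any order. -/
theorem MvPowerSeries.mem_span_X_pow_of_X_pow_mul_mem {σ k : Type*} [CommRing k]
    {s : Finset σ} {j : σ} (hj : j ∉ s) (q : ℕ) {f : MvPowerSeries σ k}
    (hf : X j ^ q * f ∈
      Ideal.span ((fun i ↦ (MvPowerSeries.X i : MvPowerSeries σ k) ^ q) '' s)) :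
    f ∈ Ideal.span ((fun i ↦ (MvPowerSeries.X i : MvPowerSeries σ k) ^ q) '' s) := by
  classical
  rw [mem_span_X_pow_iff] at hf ⊢
  intro m hm
  have h := hf (Finsupp.single j q + m) fun i hi ↦ by
    have : j ≠ i := fun h ↦ hj (h ▸ hi)
    simpa [this] using hm i hi
  rwa [X_pow_eq, coeff_add_monomial_mul, one_mul] at h

theorem MvPowerSeries.maximalIdeal_eq_span_range_X (k σ : Type*) [Field k] [Finite σ] :
    maximalIdeal (MvPowerSeries σ k) = Ideal.span (Set.range MvPowerSeries.X) := by
  have := Fintype.ofFinite σ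
  ext f
  have h := mem_span_X_pow_iff Finset.univ 1 f
  simp only [pow_one, Finset.coe_univ, Set.image_univ, Finset.mem_univ, forall_const,
    Nat.lt_one_iff] at h
  rw [h, mem_maximalIdeal, mem_nonunits_iff, isUnit_iff_constantCoeff, isUnit_iff_ne_zero,
    not_not, ← coeff_zero_eq_constantCoeff_apply]
  refine ⟨fun h m hm ↦ ?_, fun h ↦ h 0 fun _ ↦ rfl⟩
  obtain rfl : m = 0 := Finsupp.ext hm
  exact h

theorem MvPowerSeries.ringKrullDim_le (k : Type*) [Field k] (n : ℕ) :
    ringKrullDim (MvPowerSeries (Fin n) k) ≤ n := by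
  refine (ringKrullDim_le_spanFinrank_maximalIdeal _).trans ?_
  rw [maximalIdeal_eq_span_range_X]
  have h := Submodule.spanFinrank_span_le_ncard_of_finite (R := MvPowerSeries (Fin n) k)
    (Set.finite_range (MvPowerSeries.X (R := k) (σ := Fin n)))
  have h' : (Set.range (MvPowerSeries.X (R := k) (σ := Fin n))).ncard ≤ n := by
    rw [← Set.image_univ]
    refine (Set.ncard_image_le Set.finite_univ).trans ?_
    simp
  exact_mod_cast h.trans h'

theorem Ideal.smul_top_pi {A ι : Type*} [CommRing A] [Finite ι] (I : Ideal A) (v : ι → A) :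
    v ∈ (I • ⊤ : Submodule A (ι → A)) ↔ ∀ i, v i ∈ I := by
  classical
  have := Fintype.ofFinite ι
  refine ⟨fun h i ↦ ?_, fun h ↦ ?_⟩
  · induction h using Submodule.smul_induction_on' with
    | smul r hr n _ => exact I.mul_mem_right _ hr
    | add x _ y _ hx hy => exact I.add_mem hx hy
  · have : v = ∑ i, v i • (Pi.single i 1 : ι → A) := by
      simpa using (pi_eq_sum_univ' v)
    rw [this]
    exact Submodule.sum_mem _ fun i _ ↦ Submodule.smul_mem_smul (h i) trivial

instance IsPrecomplete.pi {A ι : Type*} [CommRing A] [Finite ι] (I : Ideal A)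
    [IsPrecomplete I A] : IsPrecomplete I (ι → A) := by
  refine ⟨fun f hf ↦ ?_⟩
  simp only [SModEq.sub_mem, Ideal.smul_top_pi] at hf ⊢
  have h : ∀ i, ∃ L : A, ∀ n, f n i ≡ L [SMOD (I ^ n • ⊤ : Submodule A A)] := fun i ↦
    IsPrecomplete.prec ‹_› fun {m n} hmn ↦ by
      simpa [SModEq.sub_mem] using hf hmn i
  choose L hL using h
  exact ⟨L, fun n i ↦ by simpa [SModEq.sub_mem] using hL i n⟩

theorem Module.Finite.of_isPrecomplete_of_isHausdorff {A M : Type*} [CommRing A] [AddCommGroup M]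
    [Module A M] (I : Ideal A) [IsPrecomplete I A] [IsHausdorff I M]
    [Module.Finite A (M ⧸ (I • ⊤ : Submodule A M))] : Module.Finite A M := by
  obtain ⟨n, f, hf⟩ := Module.Finite.exists_fin' A (M ⧸ (I • ⊤ : Submodule A M))
  obtain ⟨g, hg⟩ := Module.projective_lifting_property (I • ⊤ : Submodule A M).mkQ f
    (Submodule.mkQ_surjective _)
  exact Module.Finite.of_surjective g (surjective_of_mkQ_comp_surjective (I := I) (hg ▸ hf))

/-- A finite module over a domain contains a free submodule with torsion cokernel. -/
theorem exists_injective_forall_smul_mem_range (A M : Type*) [CommRing A] [IsDomain A]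
    [AddCommGroup M] [Module A M] [Module.Finite A M] :
    ∃ (ι : Type) (_ : Finite ι) (g : (ι → A) →ₗ[A] M), Function.Injective g ∧
      ∃ a : A, a ≠ 0 ∧ ∀ m, a • m ∈ LinearMap.range g := by
  classical
  obtain ⟨n, v, hv⟩ := Module.Finite.exists_fin (R := A) (M := M)
  obtain ⟨s, hs, hs'⟩ := exists_maximal_linearIndepOn A v
  have h : ∀ i, ∃ a : A, a ≠ 0 ∧ a • v i ∈ Submodule.span A (v '' s) := fun i ↦ by
    by_cases hi : i ∈ s
    · exact ⟨1, one_ne_zero, by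
        rw [one_smul]; exact Submodule.subset_span (Set.mem_image_of_mem v hi)⟩
    · exact hs' i hi
  choose a ha ha' using h
  refine ⟨s, inferInstance, Fintype.linearCombination A fun i : s ↦ v i,
    linearIndependent_iff_injective_fintypeLinearCombination.1 hs, ∏ i, a i,
    Finset.prod_ne_zero_iff.2 fun i _ ↦ ha i, fun m ↦ ?_⟩
  rw [Fintype.range_linearCombination, ← Set.image_eq_range]
  have hm : m ∈ Submodule.span A (Set.range v) := hv ▸ trivial
  induction hm using Submodule.span_induction with
  | mem x hx =>
    obtain ⟨i, rfl⟩ := hx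
    rw [← Finset.prod_erase_mul _ _ (Finset.mem_univ i), mul_smul]
    exact Submodule.smul_mem _ _ (ha' i)
  | zero => simp
  | add x y _ _ hx hy =>
    rw [smul_add]
    exact Submodule.add_mem _ hx hy
  | smul b x _ hx =>
    rw [smul_comm]
    exact Submodule.smul_mem _ _ hx

/-- A system of parameters of a complete local ring of characteristic `p` makes it a finite
algebra over a power series ring, the variables mapping to the parameters. -/
theorem IsSOP.exists_finite_mvPowerSeries_hom {R : Type*} [CommRing R] [IsLocalRing R]
    [IsNoetherianRing R] [IsAdicComplete (maximalIdeal R) R] (p : ℕ) [Fact p.Prime] [CharP R p]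
    {n : ℕ} {x : Fin n → R} (hx : IsSOP R x) :
    ∃ φ : MvPowerSeries (Fin n) (ResidueField R) →+* R,
      (∀ i, φ (MvPowerSeries.X i) = x i) ∧ φ.Finite ∧ Function.Injective φ := by
  obtain ⟨hdim, hmem, hrad⟩ := hx
  obtain ⟨f, hf⟩ := exists_residue_section R p
  obtain ⟨φ, hφX, hφC⟩ := exists_mvPowerSeries_hom (maximalIdeal R) f x hmem
  refine ⟨φ, hφX, ?_⟩
  let A := MvPowerSeries (Fin n) (ResidueField R)
  let _ : Algebra A R := φ.toAlgebra
  have hφ : algebraMap A R = φ := rfl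
  let J : Ideal A := Ideal.span (Set.range MvPowerSeries.X)
  have hJ : J.map (algebraMap A R) = Ideal.span (Set.range x) := by
    rw [Ideal.map_span, ← Set.range_comp]
    exact congr_arg _ (congr_arg _ (funext hφX))
  have htop : J.map (algebraMap A R) ≠ ⊤ := by
    rw [hJ]
    intro h
    rw [h, Ideal.radical_top] at hrad
    exact (maximalIdeal.isMaximal R).ne_top hrad.symm
  have : IsHausdorff J R :=
    IsHausdorff.map_algebraMap_iff.1 (IsHausdorff.of_isLocalRing _ _ htop)
  have hartin : IsArtinianRing (R ⧸ J.map (algebraMap A R)) := by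
    refine quotient_artinian_of_mem_minimalPrimes_of_isLocalRing _
      ⟨⟨inferInstance, ?_⟩, fun P hP _ ↦ ?_⟩
    · rw [hJ, ← hrad]; exact Ideal.le_radical
    · have := hP.1
      rw [← hrad, ← hJ]
      exact this.radical_le_iff.2 hP.2
  have hlen : IsFiniteLength R (R ⧸ J.map (algebraMap A R)) :=
    isFiniteLength_iff_isNoetherian_isArtinian.2
      ⟨inferInstance, isArtinian_of_surjective_algebraMap (R := R ⧸ J.map (algebraMap A R))
        Ideal.Quotient.mk_surjective⟩
  have hsurj : Function.Surjective (algebraMap A (ResidueField R)) := fun a ↦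
    ⟨MvPowerSeries.C a, by
      rw [IsScalarTower.algebraMap_apply A R (ResidueField R), hφ, hφC]; exact hf a⟩
  have hfin : Module.Finite A (R ⧸ J.map (algebraMap A R)) :=
    hlen.module_finite_of_residue_surjective hsurj
  have : Module.Finite A (R ⧸ (J • ⊤ : Submodule A R)) := by
    rw [Ideal.smul_top_eq_map]
    exact hfin
  have hfin : Module.Finite A R := Module.Finite.of_isPrecomplete_of_isHausdorff J
  have : IsDomain A := NoZeroDivisors.to_isDomain A
  have : Algebra.IsIntegral A R := Algebra.IsIntegral.of_finite A R
  exact ⟨hfin, algebraMap_injective_of_ringKrullDim_le A R <|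
    (MvPowerSeries.ringKrullDim_le _ n).trans hdim.le⟩

/-- A single nonzero element kills the failure of all powers of a system of parameters to be
a regular sequence. -/
theorem IsSOP.exists_ne_zero_forall_mul_mem_span_pow {R : Type*} [CommRing R] [IsDomain R]
    [IsLocalRing R] [IsNoetherianRing R] [IsAdicComplete (maximalIdeal R) R] (p : ℕ)
    [Fact p.Prime] [CharP R p] {n : ℕ} {x : Fin n → R} (hx : IsSOP R x) :
    ∃ c : R, c ≠ 0 ∧ ∀ (q : ℕ) (s : Finset (Fin n)) (j : Fin n), j ∉ s → ∀ u : R,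
      x j ^ q * u ∈ Ideal.span ((fun i ↦ x i ^ q) '' s) →
        c * u ∈ Ideal.span ((fun i ↦ x i ^ q) '' s) := by
  classical
  obtain ⟨φ, hφX, hfin, hinj⟩ := hx.exists_finite_mvPowerSeries_hom p
  let A := MvPowerSeries (Fin n) (ResidueField R)
  let _ : Algebra A R := φ.toAlgebra
  have : Module.Finite A R := hfin
  have : IsDomain A := NoZeroDivisors.to_isDomain A
  obtain ⟨ι, _, g, hg, a, ha, hag⟩ := exists_injective_forall_smul_mem_range A R
  have hφ (b : A) (r : R) : b • r = φ b * r := rfl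
  refine ⟨φ a, fun h ↦ ha (hinj (h.trans φ.map_zero.symm)), fun q s j hj u hu ↦ ?_⟩
  obtain ⟨w, hw⟩ := Submodule.mem_span_image_finset_iff_exists_fun R |>.1 hu
  choose v hv using hag
  have key : (MvPowerSeries.X j : A) ^ q • v u =
      ∑ i : s, (MvPowerSeries.X (i : Fin n) : A) ^ q • v (w i) := by
    apply hg
    simp only [map_sum, map_smul, hv, hφ, map_pow, hφX]
    rw [mul_left_comm, ← hw, Finset.mul_sum]
    exact Finset.sum_congr rfl fun i _ ↦ by simp only [smul_eq_mul]; ring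
  have hmem (l : ι) : v u l ∈
      Ideal.span ((fun i ↦ (MvPowerSeries.X i : A) ^ q) '' s) := by
    refine MvPowerSeries.mem_span_X_pow_of_X_pow_mul_mem hj q ?_
    have h := congr_fun key l
    simp only [Pi.smul_apply, smul_eq_mul, Finset.sum_apply] at h
    rw [h]
    exact Ideal.sum_mem _ fun i _ ↦
      Ideal.mul_mem_right _ _ (Ideal.subset_span ⟨i, i.2, rfl⟩)
  have := Fintype.ofFinite ι
  rw [← hφ, ← hv u, pi_eq_sum_univ' (v u), map_sum]
  refine Ideal.sum_mem _ fun l _ ↦ ?_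
  rw [map_smul, hφ]
  refine Ideal.mul_mem_right _ _ ?_
  have h := Ideal.mem_map_of_mem φ (hmem l)
  rw [Ideal.map_span, ← Set.image_comp] at h
  convert! h using 4 with i
  simp [hφX]

/-- Membership in a finitely generated ideal of a product of rings is tested componentwise. -/
theorem Pi.mem_span_image_finset_iff {κ ι R : Type*} [CommRing R] (s : Finset ι) (y : ι → κ → R)
    (a : κ → R) :
    a ∈ Ideal.span (y '' s) ↔ ∀ n, a n ∈ Ideal.span ((fun i ↦ y i n) '' s) := by
  refine ⟨fun h n ↦ ?_, fun h ↦ ?_⟩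
  · have := Ideal.mem_map_of_mem (Pi.evalRingHom (fun _ ↦ R) n) h
    rwa [Ideal.map_span, ← Set.image_comp] at this
  · choose w hw using fun n ↦ (Submodule.mem_span_image_finset_iff_exists_fun R).1 (h n)
    refine (Submodule.mem_span_image_finset_iff_exists_fun (κ → R)).2 ⟨fun i n ↦ w n i, ?_⟩
    ext n
    simpa using hw n

theorem Ideal.ofList_take_ofFn {R : Type*} [CommRing R] {n : ℕ} (x : Fin n → R) (j : Fin n) :
    Ideal.ofList ((List.ofFn x).take j) = Ideal.span (x '' (Finset.Iio j)) := by
  refine congr_arg _ (Set.ext fun r ↦ ?_)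
  simp only [Set.mem_ofPred_eq, List.mem_take_iff_getElem, Finset.coe_Iio, Set.mem_image,
    Set.mem_Iio, List.getElem_ofFn, List.length_ofFn]
  constructor
  · rintro ⟨i, hi, rfl⟩
    exact ⟨⟨i, by omega⟩, Fin.lt_def.2 (by simp; omega), rfl⟩
  · rintro ⟨i, hi, rfl⟩
    exact ⟨i, by have := Fin.lt_def.1 hi; omega, rfl⟩

/-- A criterion for being a balanced big Cohen-Macaulay algebra in terms of ideals only. -/
theorem isBalancedBigCM_of_mem_map_of_mul_mem {R B : Type*} [CommRing R] [IsLocalRing R]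
    [CommRing B] [Algebra R B] (htop : (maximalIdeal R).map (algebraMap R B) ≠ ⊤)
    (hreg : ∀ (n : ℕ) (x : Fin n → R), IsSOP R x → ∀ (s : Finset (Fin n)), ∀ j ∉ s, ∀ b : B,
      algebraMap R B (x j) * b ∈ (Ideal.span (x '' s)).map (algebraMap R B) →
        b ∈ (Ideal.span (x '' s)).map (algebraMap R B)) :
    IsBalancedBigCM R B := by
  refine ⟨fun n x hx ↦ ⟨⟨fun i hi ↦ ?_⟩, fun h ↦ htop ?_⟩, htop⟩
  · rw [List.length_ofFn] at hi
    rw [isSMulRegular_quotient_iff_mem_of_smul_mem]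
    intro b hb
    rw [Ideal.ofList_take_ofFn x ⟨i, hi⟩, Ideal.smul_top_eq_map] at hb ⊢
    refine hreg n x hx _ ⟨i, hi⟩ (by simp) b ?_
    simpa [Algebra.smul_def] using hb
  · rw [Ideal.smul_top_eq_map] at h
    have hle : Ideal.ofList (List.ofFn x) ≤ maximalIdeal R :=
      Ideal.span_le.2 fun r hr ↦ by
        obtain ⟨i, rfl⟩ := List.mem_ofFn.1 hr
        exact hx.2.1 i
    refine top_unique (le_trans (fun b _ ↦ ?_) (Ideal.map_mono hle))
    have hb : b ∈ (⊤ : Submodule R B) := trivial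
    rwa [h] at hb

section FrobeniusTwist

variable (R : Type u) [CommRing R] (p : ℕ) [Fact p.Prime] [CharP R p]

/-- The multiplicative set of constant sequences of nonzerodivisors. -/
def constNonZeroDivisors : Submonoid (ℕ → R) :=
  (nonZeroDivisors R).map (Pi.constRingHom ℕ R)

/-- The ring homomorphism sending `u` to the sequence of its `p ^ n`-th powers. -/
def iterateFrobeniusSeq : R →+* (ℕ → R) :=
  RingHom.pi fun n ↦ iterateFrobenius R p n

/-- The iterates of Frobenius, as a map to the ring of sequences in `R` with the constant
nonzerodivisors inverted. -/
abbrev frobeniusTwist : R →+* Localization (constNonZeroDivisors R) :=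
  (algebraMap (ℕ → R) _).comp (iterateFrobeniusSeq R p)

variable {R}

theorem mem_map_constNonZeroDivisors_iff [IsDomain R] (I : Ideal (ℕ → R)) (a : ℕ → R) :
    algebraMap (ℕ → R) (Localization (constNonZeroDivisors R)) a ∈
        I.map (algebraMap (ℕ → R) (Localization (constNonZeroDivisors R))) ↔
      ∃ c : R, c ≠ 0 ∧ Function.const ℕ c * a ∈ I := by
  rw [IsLocalization.algebraMap_mem_map_algebraMap_iff (constNonZeroDivisors R)]
  constructor
  · rintro ⟨_, ⟨c, hc, rfl⟩, h⟩
    exact ⟨c, nonZeroDivisors.ne_zero hc, h⟩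
  · rintro ⟨c, hc, h⟩
    exact ⟨_, ⟨c, mem_nonZeroDivisors_of_ne_zero hc, rfl⟩, h⟩

theorem map_maximalIdeal_frobeniusTwist_ne_top [IsDomain R] [IsLocalRing R]
    [IsNoetherianRing R] : (maximalIdeal R).map (frobeniusTwist R p) ≠ ⊤ := by
  rw [Ne, Ideal.eq_top_iff_one, ← Ideal.map_map, ← map_one (algebraMap (ℕ → R) _),
    mem_map_constNonZeroDivisors_iff]
  rintro ⟨c, hc, h⟩
  refine hc ?_
  rw [← Ideal.mem_bot, ← Ideal.iInf_pow_eq_bot_of_isLocalRing _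
    (maximalIdeal.isMaximal R).ne_top, Ideal.mem_iInf]
  intro n
  have h := Ideal.mem_map_of_mem (Pi.evalRingHom (fun _ ↦ R) n) h
  rw [Ideal.map_map, mul_one] at h
  have hle : (maximalIdeal R).map
      ((Pi.evalRingHom (fun _ ↦ R) n).comp (iterateFrobeniusSeq R p)) ≤
        maximalIdeal R ^ p ^ n :=
    Ideal.map_le_iff_le_comap.2 fun r hr ↦ Ideal.pow_mem_pow hr _
  exact Ideal.pow_le_pow_right ((Nat.lt_pow_self (Fact.out : p.Prime).one_lt).le) (hle h)

theorem IsSOP.mem_map_frobeniusTwist_of_mul_mem [IsDomain R] [IsLocalRing R] [IsNoetherianRing R]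
    [IsAdicComplete (maximalIdeal R) R] {n : ℕ} {x : Fin n → R} (hx : IsSOP R x)
    {s : Finset (Fin n)} {j : Fin n} (hj : j ∉ s) {b : Localization (constNonZeroDivisors R)}
    (hb : frobeniusTwist R p (x j) * b ∈ (Ideal.span (x '' s)).map (frobeniusTwist R p)) :
    b ∈ (Ideal.span (x '' s)).map (frobeniusTwist R p) := by
  obtain ⟨c, hc, hcx⟩ := hx.exists_ne_zero_forall_mul_mem_span_pow p
  obtain ⟨a, t, rfl⟩ := IsLocalization.exists_mk'_eq (constNonZeroDivisors R) b
  rw [RingHom.comp_apply, ← IsLocalization.mk'_one (M := constNonZeroDivisors R),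
    ← IsLocalization.mk'_mul, one_mul] at hb
  rw [← Ideal.map_map, IsLocalization.mk'_mem_iff, mem_map_constNonZeroDivisors_iff] at hb ⊢
  rw [Ideal.map_span, ← Set.image_comp] at hb ⊢
  obtain ⟨d, hd, h⟩ := hb
  refine ⟨c * d, mul_ne_zero hc hd, ?_⟩
  rw [Pi.mem_span_image_finset_iff] at h ⊢
  intro m
  have := hcx (p ^ m) s j hj (d * a m) (by
    have := h m
    rwa [Pi.mul_apply, Pi.mul_apply, Function.const_apply, mul_left_comm] at this)
  rwa [← mul_assoc] at this

end FrobeniusTwist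

/-- **Corollary (Hochster–Huneke; Dietz, Cor. 6.9 / `bigCMexist`).** If `(R,m)` is a
complete Noetherian local domain of positive prime characteristic `p`, then there exists a
balanced big Cohen-Macaulay `R`-algebra. -/
theorem balanced_bigCM_exists
    (R : Type u) [CommRing R] [IsDomain R] [IsLocalRing R] [IsNoetherianRing R]
    [IsAdicComplete (maximalIdeal R) R]
    (p : ℕ) [Fact p.Prime] [CharP R p] :
    ∃ (B : Type u) (_ : CommRing B) (_ : Algebra R B), IsBalancedBigCM R B := by
  exact ⟨Localization (constNonZeroDivisors R), inferInstance, (frobeniusTwist R p).toAlgebra,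
    @isBalancedBigCM_of_mem_map_of_mul_mem _ _ _ _ _ (frobeniusTwist R p).toAlgebra
      (map_maximalIdeal_frobeniusTwist_ne_top p)
      fun _ _ hx _ _ hj _ ↦ hx.mem_map_frobeniusTwist_of_mul_mem p hj⟩
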